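/- arXiv:1012.4228 — 3 statements merged into one kernel-verified Lean document; each statement's English description precedes it below -/
import Mathlib

section
/- Let a₀ ∈ (1/2, 2/3) satisfy 27a₀² − 54a₀³ = −1. For every a ∈ (0, 1/3) ∪ (1/3, 1/2) ∪ (1/2, a₀) and every Okamoto function F with parameter a, the set of points x ∈ [0,1] at which F is not differentiable within [0,1] is dense in [0,1]. -/
open Set MeasureTheory Filter

/-- `F : ℝ → ℝ` (regarded as a function on `[0,1]`) is an Okamoto function with
parameter `a` if it is continuous on `[0,1]` and satisfies the three self-affine
functional equations for all `x ∈ [0,1]`. -/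
def IsOkamoto (a : ℝ) (F : ℝ → ℝ) : Prop :=
  ContinuousOn F (Set.Icc 0 1) ∧
  ∀ x ∈ Set.Icc (0 : ℝ) 1,
    F (x / 3) = a * F x ∧
    F ((2 - x) / 3) = (2 * a - 1) * F x + (1 - a) ∧
    F ((2 + x) / 3) = a * F x + (1 - a)

/-- A function that scales by `q` along points approaching `p` at rate `r`, with `|r| < |q|`, is
not differentiable at `p`. -/
theorem not_differentiableWithinAt_of_scaling {F : ℝ → ℝ} {s : Set ℝ} {p r q c d : ℝ}
    (hr0 : r ≠ 0) (hr1 : |r| < 1) (hrq : |r| < |q|) (hc : c ≠ 0) (hd : d ≠ 0)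
    (hs : ∀ n : ℕ, p + r ^ n * c ∈ s) (hF : ∀ n : ℕ, F (p + r ^ n * c) = F p + q ^ n * d) :
    ¬ DifferentiableWithinAt ℝ F s p := by
  intro h
  have hslope := hasDerivWithinAt_iff_tendsto_slope.1 h.hasDerivWithinAt
  have hpow : Tendsto (fun n : ℕ => p + r ^ n * c) atTop (nhds p) := by
    simpa using ((tendsto_pow_atTop_nhds_zero_of_abs_lt_one hr1).mul_const c).const_add p
  have hseq : Tendsto (fun n : ℕ => p + r ^ n * c) atTop (nhdsWithin p (s \ {p})) :=
    tendsto_nhdsWithin_iff.2 ⟨hpow, Eventually.of_forall fun n => ⟨hs n, by simp [hr0, hc]⟩⟩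
  have habs := (hslope.comp hseq).abs
  have heq : ∀ n : ℕ, |slope F p (p + r ^ n * c)| = (|q| / |r|) ^ n * |d / c| := by
    intro n
    rw [slope_def_field, hF n, ← abs_div, ← abs_pow, ← abs_mul, add_sub_cancel_left,
      add_sub_cancel_left, mul_div_mul_comm, div_pow]
  have hratio : 1 < |q| / |r| := (one_lt_div (abs_pos.2 hr0)).2 hrq
  have hinf : Tendsto (fun n : ℕ => (|q| / |r|) ^ n * |d / c|) atTop atTop :=
    (tendsto_pow_atTop_atTop_of_one_lt hratio).atTop_mul_const (abs_pos.2 (div_ne_zero hd hc))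
  exact not_tendsto_nhds_of_tendsto_atTop hinf _ (habs.congr heq)

/-- A nonempty subset of `[0,1]` stable under the three contractions is dense in `[0,1]`. -/
theorem Icc_subset_closure_of_stable {S : Set ℝ} (hS : S ⊆ Icc 0 1) (hne : S.Nonempty)
    (h0 : ∀ x ∈ S, x / 3 ∈ S) (h1 : ∀ x ∈ S, (2 - x) / 3 ∈ S) (h2 : ∀ x ∈ S, (2 + x) / 3 ∈ S) :
    Icc (0 : ℝ) 1 ⊆ closure S := by
  have key : ∀ n : ℕ, ∀ y ∈ Icc (0 : ℝ) 1, ∃ x ∈ S, |y - x| ≤ (1 / 3) ^ n := by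
    intro n
    induction n with
    | zero =>
      rintro y ⟨hy0, hy1⟩
      obtain ⟨x, hx⟩ := hne
      obtain ⟨hx0, hx1⟩ := hS hx
      exact ⟨x, hx, by rw [pow_zero, abs_le]; constructor <;> linarith⟩
    | succ n ih =>
      rintro y ⟨hy0, hy1⟩
      rw [pow_succ]
      rcases le_total y (1 / 3) with hy | hy
      · obtain ⟨x, hx, hxy⟩ := ih (3 * y) ⟨by linarith, by linarith⟩
        refine ⟨_, h0 x hx, ?_⟩
        rw [abs_le] at hxy ⊢
        constructor <;> linarith
      rcases le_total y (2 / 3) with hy' | hy'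
      · obtain ⟨x, hx, hxy⟩ := ih (2 - 3 * y) ⟨by linarith, by linarith⟩
        refine ⟨_, h1 x hx, ?_⟩
        rw [abs_le] at hxy ⊢
        constructor <;> linarith
      · obtain ⟨x, hx, hxy⟩ := ih (3 * y - 2) ⟨by linarith, by linarith⟩
        refine ⟨_, h2 x hx, ?_⟩
        rw [abs_le] at hxy ⊢
        constructor <;> linarith
  intro y hy
  refine Metric.mem_closure_iff.2 fun ε hε => ?_
  obtain ⟨n, hn⟩ := exists_pow_lt_of_lt_one hε (by norm_num : (1 / 3 : ℝ) < 1)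
  obtain ⟨x, hx, hxy⟩ := key n y hy
  exact ⟨x, hx, by rw [Real.dist_eq]; linarith⟩

/-- Differentiability at `φ x` passes to `x` when `F ∘ φ` is an affine function of `F`. -/
theorem DifferentiableWithinAt.of_comp_eq_affine {F φ : ℝ → ℝ} {s : Set ℝ} {x q b : ℝ}
    (hq : q ≠ 0) (hφ : DifferentiableWithinAt ℝ φ s x) (hs : MapsTo φ s s) (hx : x ∈ s)
    (hF : ∀ y ∈ s, F (φ y) = q * F y + b) (h : DifferentiableWithinAt ℝ F s (φ x)) :
    DifferentiableWithinAt ℝ F s x := by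
  have hcomp := ((h.comp x hφ hs).sub_const b).const_mul q⁻¹
  have heq : ∀ y ∈ s, F y = q⁻¹ * ((F ∘ φ) y - b) := by
    intro y hy
    rw [Function.comp_apply, hF y hy]
    field_simp
    ring
  exact hcomp.congr heq (heq x hx)

namespace IsOkamoto

variable {a : ℝ} {F : ℝ → ℝ}

theorem apply_zero (hF : IsOkamoto a F) (ha : a ≠ 1) : F 0 = 0 := by
  have h := (hF.2 0 (by norm_num)).1
  rw [zero_div] at h
  have h' : (1 - a) * F 0 = 0 := by linarith
  exact (mul_eq_zero.1 h').resolve_left (sub_ne_zero.2 ha.symm)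

theorem apply_one (hF : IsOkamoto a F) (ha : a ≠ 1) : F 1 = 1 := by
  have h := (hF.2 1 (by norm_num)).2.2
  norm_num at h
  exact mul_left_cancel₀ (sub_ne_zero.2 ha.symm) (by linarith)

theorem apply_half (hF : IsOkamoto a F) (ha : a ≠ 1) : F (1 / 2) = 1 / 2 := by
  have h := (hF.2 (1 / 2) (by norm_num)).2.1
  norm_num at h
  exact mul_left_cancel₀ (sub_ne_zero.2 ha.symm) (by linarith)

theorem not_differentiableWithinAt_zero (hF : IsOkamoto a F) (ha : 1 / 3 < a) (ha1 : a ≠ 1) :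
    ¬ DifferentiableWithinAt ℝ F (Icc 0 1) 0 := by
  have hmem : ∀ n : ℕ, (0 : ℝ) + (1 / 3) ^ n * 1 ∈ Icc (0 : ℝ) 1 := fun n => by
    rw [zero_add, mul_one]
    exact ⟨by positivity, pow_le_one₀ (by norm_num) (by norm_num)⟩
  refine not_differentiableWithinAt_of_scaling (r := 1 / 3) (q := a) (c := 1) (d := 1)
    (by norm_num) (by norm_num [abs_of_pos]) ?_ one_ne_zero one_ne_zero hmem fun n => ?_
  · rw [abs_of_pos (by norm_num), abs_of_pos (by linarith)]
    exact ha
  · rw [hF.apply_zero ha1]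
    induction n with
    | zero => simpa using hF.apply_one ha1
    | succ n ih =>
      rw [show (0 : ℝ) + (1 / 3) ^ (n + 1) * 1 = (0 + (1 / 3) ^ n * 1) / 3 by ring,
        (hF.2 _ (hmem n)).1, ih]
      ring

theorem not_differentiableWithinAt_half (hF : IsOkamoto a F) (ha : a < 1 / 3) :
    ¬ DifferentiableWithinAt ℝ F (Icc 0 1) (1 / 2) := by
  have ha1 : a ≠ 1 := by linarith
  have hmem : ∀ n : ℕ, (1 / 2 : ℝ) + (-1 / 3) ^ n * (1 / 2) ∈ Icc (0 : ℝ) 1 := fun n => by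
    have h : |(-1 / 3 : ℝ) ^ n| ≤ 1 := by
      rw [abs_pow]
      exact pow_le_one₀ (abs_nonneg _) (by rw [abs_le]; norm_num)
    rw [abs_le] at h
    constructor <;> linarith
  refine not_differentiableWithinAt_of_scaling (r := -1 / 3) (q := 2 * a - 1) (c := 1 / 2)
    (d := 1 / 2) (by norm_num) (by rw [abs_lt]; norm_num) ?_ (by norm_num) (by norm_num) hmem
    fun n => ?_
  · rw [abs_of_neg (by norm_num), abs_of_neg (by linarith)]
    linarith
  · rw [hF.apply_half ha1]
    induction n with
    | zero =>
      norm_num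
      exact hF.apply_one ha1
    | succ n ih =>
      rw [show (1 / 2 : ℝ) + (-1 / 3) ^ (n + 1) * (1 / 2) =
          (2 - (1 / 2 + (-1 / 3) ^ n * (1 / 2))) / 3 by ring,
        (hF.2 _ (hmem n)).2.1, ih]
      ring

theorem Icc_subset_closure_not_differentiable (hF : IsOkamoto a F) (h0 : a ≠ 0) (h1 : a ≠ 1)
    (h3 : a ≠ 1 / 3) (h2 : a ≠ 1 / 2) :
    Icc (0 : ℝ) 1 ⊆
      closure {x ∈ Icc (0 : ℝ) 1 | ¬ DifferentiableWithinAt ℝ F (Icc 0 1) x} := by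
  have h2' : 2 * a - 1 ≠ 0 := fun h => h2 (by linarith)
  have hstable : ∀ {φ : ℝ → ℝ} {q b : ℝ}, q ≠ 0 → Differentiable ℝ φ →
      MapsTo φ (Icc 0 1) (Icc 0 1) → (∀ y ∈ Icc (0 : ℝ) 1, F (φ y) = q * F y + b) →
      ∀ x ∈ {x ∈ Icc (0 : ℝ) 1 | ¬ DifferentiableWithinAt ℝ F (Icc 0 1) x},
        φ x ∈ {x ∈ Icc (0 : ℝ) 1 | ¬ DifferentiableWithinAt ℝ F (Icc 0 1) x} :=
    fun hq hφ hs hFφ x hx => ⟨hs hx.1, fun h => hx.2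
      (.of_comp_eq_affine hq (hφ x).differentiableWithinAt hs hx.1 hFφ h)⟩
  refine Icc_subset_closure_of_stable (fun x hx => hx.1) ?_
    (hstable (φ := fun x => x / 3) (b := 0) h0 (by fun_prop) ?_
      fun y hy => by rw [(hF.2 y hy).1, add_zero])
    (hstable (φ := fun x => (2 - x) / 3) h2' (by fun_prop) ?_ fun y hy => (hF.2 y hy).2.1)
    (hstable (φ := fun x => (2 + x) / 3) h0 (by fun_prop) ?_ fun y hy => (hF.2 y hy).2.2)
  · rcases lt_or_gt_of_ne h3 with h | h
    · exact ⟨1 / 2, by norm_num, hF.not_differentiableWithinAt_half h⟩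
    · exact ⟨0, by norm_num, hF.not_differentiableWithinAt_zero h h1⟩
  all_goals
    rintro x ⟨hx0, hx1⟩
    constructor <;> dsimp only <;> linarith

end IsOkamoto

/-- For every `a ∈ (0,1/3) ∪ (1/3,1/2) ∪ (1/2,a₀)`, the set of points of `[0,1]` at which
the Okamoto function with parameter `a` is not differentiable within `[0,1]` is dense
in `[0,1]`. -/
theorem okamoto_nondiff_points_dense (a₀ : ℝ) (ha₀ : a₀ ∈ Set.Ioo (1 / 2 : ℝ) (2 / 3))
    (hroot : 27 * a₀ ^ 2 - 54 * a₀ ^ 3 = -1)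
    (a : ℝ)
    (ha : a ∈ Set.Ioo (0 : ℝ) (1 / 3) ∪ Set.Ioo (1 / 3 : ℝ) (1 / 2) ∪ Set.Ioo (1 / 2 : ℝ) a₀)
    (F : ℝ → ℝ) (hF : IsOkamoto a F) :
    Set.Icc (0 : ℝ) 1 ⊆
      closure {x ∈ Set.Icc (0 : ℝ) 1 | ¬ DifferentiableWithinAt ℝ F (Set.Icc 0 1) x} := by
  rcases ha with (ha | ha) | ha <;> obtain ⟨hl, hu⟩ := ha <;> have hu₀ := ha₀.2 <;>
    exact hF.Icc_subset_closure_not_differentiable (by linarith) (by linarith) (by linarith)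
      (by linarith)
end

section
/- For every a ∈ (0, 1/2] and every Okamoto function F with parameter a, the one-dimensional Hausdorff measure of the graph Γ_F = {(x, F(x)) : x ∈ [0,1]} ⊆ ℝ² satisfies √2 ≤ H¹(Γ_F) ≤ 2. -/
open Set MeasureTheory Filter

/-- The graph of `F` over `[0,1]`, as a subset of the Euclidean plane. -/
noncomputable def graphE (F : ℝ → ℝ) : Set (EuclideanSpace ℝ (Fin 2)) :=
  (fun x : ℝ => (WithLp.equiv 2 (Fin 2 → ℝ)).symm ![x, F x]) '' Set.Icc 0 1

/-- The `ℓ¹`-type functional `v ↦ v 0 + v 1`, whose restriction to the graph of a monotone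
function controls arc length from both sides. -/
noncomputable def coordSum (v : EuclideanSpace ℝ (Fin 2)) : ℝ := v 0 + v 1

theorem lipschitzWith_coordSum : LipschitzWith (NNReal.sqrt 2) coordSum := by
  refine LipschitzWith.of_dist_le_mul fun v w => ?_
  rw [EuclideanSpace.dist_eq, Fin.sum_univ_two, Real.dist_eq, Real.dist_eq, Real.dist_eq,
    Real.coe_sqrt, NNReal.coe_ofNat, ← Real.sqrt_mul (by norm_num)]
  apply Real.le_sqrt_of_sq_le
  rw [sq_abs, sq_abs, sq_abs, coordSum, coordSum]
  nlinarith [sq_nonneg ((v 0 - w 0) - (v 1 - w 1))]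

theorem dist_le_dist_coordSum {F : ℝ → ℝ} (hF : MonotoneOn F (Icc 0 1))
    {v w : EuclideanSpace ℝ (Fin 2)} (hv : v ∈ graphE F) (hw : w ∈ graphE F) :
    dist v w ≤ dist (coordSum v) (coordSum w) := by
  obtain ⟨x, hx, rfl⟩ := hv
  obtain ⟨y, hy, rfl⟩ := hw
  have hxy : 0 ≤ (x - y) * (F x - F y) := by
    rcases le_total x y with h | h
    · exact mul_nonneg_of_nonpos_of_nonpos (by linarith) (by linarith [hF hx hy h])
    · exact mul_nonneg (by linarith) (by linarith [hF hy hx h])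
  rw [EuclideanSpace.dist_eq, Fin.sum_univ_two, Real.dist_eq, Real.dist_eq, Real.dist_eq]
  apply Real.sqrt_le_iff.2 ⟨abs_nonneg _, ?_⟩
  simp only [sq_abs, coordSum, WithLp.equiv_symm_apply, Matrix.cons_val_zero, Matrix.cons_val_one]
  nlinarith

/-- The graph over `[0,1]` of a monotone function from `0` to `1` has length at most `2`. -/
theorem hausdorffMeasure_graphE_le {F : ℝ → ℝ} (hF : MonotoneOn F (Icc 0 1))
    (h0 : F 0 = 0) (h1 : F 1 = 1) : μH[1] (graphE F) ≤ 2 := by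
  have hanti : AntilipschitzWith 1 (fun p : graphE F => coordSum p) :=
    AntilipschitzWith.of_le_mul_dist fun p q => by
      simpa [Subtype.dist_eq] using dist_le_dist_coordSum hF p.2 q.2
  have hsub : (fun p : graphE F => coordSum p) '' univ ⊆ Icc 0 2 := by
    rintro _ ⟨⟨_, x, hx, rfl⟩, -, rfl⟩
    have hl := hF (left_mem_Icc.2 zero_le_one) hx hx.1
    have hr := hF hx (right_mem_Icc.2 zero_le_one) hx.2
    simp only [coordSum, WithLp.equiv_symm_apply, Matrix.cons_val_zero, Matrix.cons_val_one]
    constructor <;> linarith [hx.1, hx.2]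
  calc μH[1] (graphE F) = μH[1] (Subtype.val '' (univ : Set (graphE F))) := by
        rw [image_univ, Subtype.range_coe]
    _ = μH[1] (univ : Set (graphE F)) :=
        isometry_subtype_coe.hausdorffMeasure_image (Or.inl zero_le_one) _
    _ ≤ μH[1] ((fun p : graphE F => coordSum p) '' univ) := by
        simpa using hanti.le_hausdorffMeasure_image zero_le_one univ
    _ ≤ μH[1] (Icc (0 : ℝ) 2) := measure_mono hsub
    _ = 2 := by simp [hausdorffMeasure_real]

/-- The graph over `[0,1]` of a continuous function from `0` to `1` has length at least `√2`. -/
theorem sqrt_two_le_hausdorffMeasure_graphE {F : ℝ → ℝ} (hF : ContinuousOn F (Icc 0 1))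
    (h0 : F 0 = 0) (h1 : F 1 = 1) : ENNReal.ofReal (Real.sqrt 2) ≤ μH[1] (graphE F) := by
  have hsub : Icc (0 : ℝ) 2 ⊆ coordSum '' graphE F := by
    have hivt := intermediate_value_Icc (zero_le_one' ℝ) (continuousOn_id.add hF)
    simp only [Pi.add_apply, id_eq, h0, h1, add_zero, one_add_one_eq_two] at hivt
    intro t ht
    obtain ⟨x, hx, hxt⟩ := hivt ht
    exact ⟨_, ⟨x, hx, rfl⟩, by simpa [coordSum] using hxt⟩
  have hle : (2 : ENNReal) ≤ ENNReal.ofReal (Real.sqrt 2) * μH[1] (graphE F) :=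
    calc (2 : ENNReal) = μH[1] (Icc (0 : ℝ) 2) := by simp [hausdorffMeasure_real]
      _ ≤ μH[1] (coordSum '' graphE F) := measure_mono hsub
      _ ≤ _ := by
        have := lipschitzWith_coordSum.hausdorffMeasure_image_le zero_le_one (graphE F)
        have hs : ENNReal.ofReal (Real.sqrt 2) = (NNReal.sqrt 2 : NNReal) := by
          rw [ENNReal.ofReal]
          congr 1
          ext
          simp
        rwa [ENNReal.rpow_one, ← hs] at this
  have hmul : ENNReal.ofReal (Real.sqrt 2) * ENNReal.ofReal (Real.sqrt 2) = 2 := by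
    rw [← ENNReal.ofReal_mul (Real.sqrt_nonneg _), Real.mul_self_sqrt zero_le_two]
    simp
  exact (ENNReal.mul_le_mul_iff_right (by simp) ENNReal.ofReal_ne_top).1 (hmul.trans_le hle)

namespace IsOkamoto

variable {a : ℝ} {F : ℝ → ℝ}

theorem map_zero (hF : IsOkamoto a F) (ha : a < 1) : F 0 = 0 := by
  have h := (hF.2 0 (by simp)).1
  rw [zero_div] at h
  have : (1 - a) * F 0 = 0 := by linarith
  exact (mul_eq_zero.1 this).resolve_left (by linarith)

theorem map_one (hF : IsOkamoto a F) (ha : a < 1) : F 1 = 1 := by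
  have h := (hF.2 1 (by simp)).2.2
  norm_num at h
  have : (1 - a) * (F 1 - 1) = 0 := by linarith
  linarith [(mul_eq_zero.1 this).resolve_left (by linarith)]

theorem eq_left (hF : IsOkamoto a F) {x : ℝ} (h0 : 0 ≤ x) (h1 : x ≤ 1 / 3) :
    F x = a * F (3 * x) := by
  have h := (hF.2 (3 * x) ⟨by linarith, by linarith⟩).1
  rwa [show 3 * x / 3 = x by ring] at h

theorem eq_middle (hF : IsOkamoto a F) {x : ℝ} (h0 : 1 / 3 ≤ x) (h1 : x ≤ 2 / 3) :
    F x = (2 * a - 1) * F (2 - 3 * x) + (1 - a) := by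
  have h := (hF.2 (2 - 3 * x) ⟨by linarith, by linarith⟩).2.1
  rwa [show (2 - (2 - 3 * x)) / 3 = x by ring] at h

theorem eq_right (hF : IsOkamoto a F) {x : ℝ} (h0 : 2 / 3 ≤ x) (h1 : x ≤ 1) :
    F x = a * F (3 * x - 2) + (1 - a) := by
  have h := (hF.2 (3 * x - 2) ⟨by linarith, by linarith⟩).2.2
  rwa [show (2 + (3 * x - 2)) / 3 = x by ring] at h

theorem mem_Icc (hF : IsOkamoto a F) (ha : a ∈ Ioc (0 : ℝ) (1 / 2)) {x : ℝ}
    (hx : x ∈ Icc (0 : ℝ) 1) : F x ∈ Icc (0 : ℝ) 1 := by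
  obtain ⟨z, hz, hmax⟩ := isCompact_Icc.exists_isMaxOn (nonempty_Icc.2 (zero_le_one' ℝ))
    ((hF.1.sub continuousOn_const).abs : ContinuousOn (fun x => |F x - 1 / 2|) (Icc 0 1))
  obtain ⟨ha0, ha1⟩ := ha
  have hb : ∀ y, 0 ≤ y → y ≤ 1 → |F y - 1 / 2| ≤ |F z - 1 / 2| := fun y h0 h1 => hmax ⟨h0, h1⟩
  set D := |F z - 1 / 2| with hD
  have hD2 : D ≤ 1 / 2 := by
    by_contra! hlt
    have hlt1 : 0 < (1 - a) * (D - 1 / 2) := mul_pos (by linarith) (by linarith)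
    suffices h : D < D from lt_irrefl _ h
    conv_lhs => rw [hD]
    rw [abs_lt]
    rcases le_total z (1 / 3) with h | h
    · have hv := abs_le.1 (hb (3 * z) (by linarith [hz.1]) (by linarith))
      rw [hF.eq_left hz.1 h]
      constructor <;> nlinarith
    rcases le_total z (2 / 3) with h' | h'
    · have hv := abs_le.1 (hb (2 - 3 * z) (by linarith) (by linarith))
      rw [hF.eq_middle h h']
      constructor <;> nlinarith
    · have hv := abs_le.1 (hb (3 * z - 2) (by linarith) (by linarith [hz.2]))
      rw [hF.eq_right h' hz.2]
      constructor <;> nlinarith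
  have := abs_le.1 ((hb x hx.1 hx.2).trans hD2)
  constructor <;> linarith

theorem monotoneOn (hF : IsOkamoto a F) (ha : a ∈ Ioc (0 : ℝ) (1 / 2)) :
    MonotoneOn F (Icc 0 1) := by
  have hcomp : IsCompact ((Icc (0 : ℝ) 1 ×ˢ Icc (0 : ℝ) 1) ∩ {p | p.1 ≤ p.2}) :=
    (isCompact_Icc.prod isCompact_Icc).inter_right (isClosed_le continuous_fst continuous_snd)
  have hcont : ContinuousOn (fun p : ℝ × ℝ => F p.2 - F p.1)
      ((Icc (0 : ℝ) 1 ×ˢ Icc (0 : ℝ) 1) ∩ {p | p.1 ≤ p.2}) :=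
    (hF.1.comp continuousOn_snd fun p hp => hp.1.2).sub
      (hF.1.comp continuousOn_fst fun p hp => hp.1.1)
  obtain ⟨⟨x, y⟩, ⟨⟨hx, hy⟩, hxy⟩, hmin⟩ := hcomp.exists_isMinOn ⟨(0, 1), by simp⟩ hcont
  simp only [mem_ofPred_eq] at hx hy hxy
  have hb : ∀ u v, 0 ≤ u → u ≤ v → v ≤ 1 → F y - F x ≤ F v - F u := fun u v hu huv hv =>
    hmin (a := (u, v)) ⟨⟨⟨hu, huv.trans hv⟩, ⟨hu.trans huv, hv⟩⟩, huv⟩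
  suffices hnonneg : 0 ≤ F y - F x by
    intro u hu v hv huv
    linarith [hb u v hu.1 huv hv.2]
  have hI : ∀ u, 0 ≤ u → u ≤ 1 → 0 ≤ F u ∧ F u ≤ 1 := fun u h0 h1 => hF.mem_Icc ha ⟨h0, h1⟩
  obtain ⟨ha0, ha1⟩ := ha
  obtain ⟨hx0, hx1⟩ := hx
  obtain ⟨hy0, hy1⟩ := hy
  have hleft : ∀ u, 0 ≤ u → u ≤ 1 / 3 → F u ≤ a := fun u h0 h1 => by
    rw [hF.eq_left h0 h1]
    nlinarith [hI (3 * u) (by linarith) (by linarith)]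
  have hmid : ∀ u, 1 / 3 ≤ u → u ≤ 2 / 3 → a ≤ F u ∧ F u ≤ 1 - a := fun u h0 h1 => by
    rw [hF.eq_middle h0 h1]
    have := hI (2 - 3 * u) (by linarith) (by linarith)
    constructor <;> nlinarith
  have hright : ∀ u, 2 / 3 ≤ u → u ≤ 1 → 1 - a ≤ F u := fun u h0 h1 => by
    rw [hF.eq_right h0 h1]
    nlinarith [hI (3 * u - 2) (by linarith) (by linarith)]
  by_contra! hneg
  rcases le_total y (1 / 3) with h1 | h1
  · have hv := hb (3 * x) (3 * y) (by linarith) (by linarith) (by linarith)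
    have ex := hF.eq_left hx0 (hxy.trans h1)
    have ey := hF.eq_left hy0 h1
    nlinarith
  rcases le_total y (2 / 3) with h2 | h2
  · rcases le_total x (1 / 3) with h3 | h3
    · linarith [hleft x hx0 h3, (hmid y h1 h2).1]
    · have hv := hb (2 - 3 * y) (2 - 3 * x) (by linarith) (by linarith) (by linarith)
      have ex := hF.eq_middle h3 (hxy.trans h2)
      have ey := hF.eq_middle h1 h2
      nlinarith
  · have hry := hright y h2 hy1
    rcases le_total x (1 / 3) with h3 | h3
    · linarith [hleft x hx0 h3]
    rcases le_total x (2 / 3) with h4 | h4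
    · linarith [(hmid x h3 h4).2]
    · have hv := hb (3 * x - 2) (3 * y - 2) (by linarith) (by linarith) (by linarith)
      have ex := hF.eq_right h4 hx1
      have ey := hF.eq_right h2 hy1
      nlinarith

end IsOkamoto

/-- For every `a ∈ (0,1/2]`, the one-dimensional Hausdorff measure of the graph of the
Okamoto function with parameter `a` lies between `√2` and `2`. -/
theorem okamoto_graph_hausdorffMeasure_bounds (a : ℝ) (ha : a ∈ Set.Ioc (0 : ℝ) (1 / 2))
    (F : ℝ → ℝ) (hF : IsOkamoto a F) :
    ENNReal.ofReal (Real.sqrt 2) ≤ μH[1] (graphE F) ∧ μH[1] (graphE F) ≤ 2 := by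
  have ha1 : a < 1 := by linarith [ha.2]
  exact ⟨sqrt_two_le_hausdorffMeasure_graphE hF.1 (hF.map_zero ha1) (hF.map_one ha1),
    hausdorffMeasure_graphE_le (hF.monotoneOn ha) (hF.map_zero ha1) (hF.map_one ha1)⟩
end

section
/- Let a ∈ (0,1) and let F be an Okamoto function with parameter a. Define w₁, w₂, w₃ : ℝ² → ℝ² by w₁(x,y) = (x/3, ay), w₂(x,y) = ((2−x)/3, (2a−1)y + (1−a)), w₃(x,y) = ((2+x)/3, ay + (1−a)), and define sets E_i ⊆ ℝ² by E₀ = [0,1] × [0,1] and E_{i+1} = w₁(E_i) ∪ w₂(E_i) ∪ w₃(E_i) for i ≥ 0. Then E_{i+1} ⊆ E_i for all i ≥ 0, and ⋂_{i=0}^{∞} E_i = Γ_F, the graph of F. -/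
open Set MeasureTheory Filter

/-- The graph of `F` over `[0,1]`, as a subset of `ℝ × ℝ`. -/
def okamotoGraph (F : ℝ → ℝ) : Set (ℝ × ℝ) :=
  (fun x : ℝ => (x, F x)) '' Set.Icc 0 1

/-- Every point of `[0,1]` is the image of a point of `[0,1]` under one of the three
first-coordinate maps of the iterated function system. -/
lemma exists_preimage_thirds {x : ℝ} (hx : x ∈ Set.Icc (0 : ℝ) 1) :
    ∃ t ∈ Set.Icc (0 : ℝ) 1, x = t / 3 ∨ x = (2 - t) / 3 ∨ x = (2 + t) / 3 := by
  obtain ⟨h0, h1⟩ := hx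
  rcases le_total x (1 / 3) with h | h
  · exact ⟨3 * x, ⟨by linarith, by linarith⟩, Or.inl (by ring)⟩
  rcases le_total x (2 / 3) with h' | h'
  · exact ⟨2 - 3 * x, ⟨by linarith, by linarith⟩, Or.inr (Or.inl (by ring))⟩
  · exact ⟨3 * x - 2, ⟨by linarith, by linarith⟩, Or.inr (Or.inr (by ring))⟩

/-- An Okamoto function maps `[0,1]` into `[0,1]`. -/
lemma IsOkamoto.mapsTo_Icc {a : ℝ} (ha : a ∈ Set.Ioo (0 : ℝ) 1) {F : ℝ → ℝ}
    (hF : IsOkamoto a F) : MapsTo F (Set.Icc 0 1) (Set.Icc 0 1) := by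
  obtain ⟨ha0, ha1⟩ := ha
  obtain ⟨hc, hF⟩ := hF
  obtain ⟨x, hx, hmax⟩ := isCompact_Icc.exists_isMaxOn (nonempty_Icc.2 zero_le_one)
    ((hc.sub continuousOn_const).abs : ContinuousOn (fun x => |F x - 1 / 2|) (Set.Icc 0 1))
  have hS : |F x - 1 / 2| ≤ 1 / 2 := by
    obtain ⟨t, ht, h⟩ := exists_preimage_thirds hx
    have hle : |F t - 1 / 2| ≤ |F x - 1 / 2| := hmax ht
    obtain ⟨h₁, h₂, h₃⟩ := hF t ht
    obtain ⟨hl, hu⟩ := abs_le.1 hle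
    by_contra! hS
    rcases h with rfl | rfl | rfl
    · rw [h₁] at hS hl hu
      rcases abs_cases (a * F t - 1 / 2) with ⟨h, -⟩ | ⟨h, -⟩ <;> rw [h] at hS hl hu <;> nlinarith
    · have hc1 : |2 * a - 1| < 1 := abs_lt.2 ⟨by linarith, by linarith⟩
      have hG : (2 * a - 1) * F t + (1 - a) - 1 / 2 = (2 * a - 1) * (F t - 1 / 2) := by ring
      rw [h₂, hG, abs_mul] at hS hle
      have hpos : 0 < |F t - 1 / 2| :=
        pos_of_mul_pos_right (one_half_pos.trans hS) (abs_nonneg _)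
      linarith [mul_lt_mul_of_pos_right hc1 hpos]
    · rw [h₃] at hS hl hu
      rcases abs_cases (a * F t + (1 - a) - 1 / 2) with ⟨h, -⟩ | ⟨h, -⟩ <;>
        rw [h] at hS hl hu <;> nlinarith
  intro y hy
  have hy' : |F y - 1 / 2| ≤ 1 / 2 := (hmax hy).trans hS
  obtain ⟨hl, hu⟩ := abs_le.1 hy'
  exact ⟨by linarith, by linarith⟩

/-- The sets `E i` obtained by iterating the IFS `w₁, w₂, w₃` on the unit square are
nested and their intersection is the graph of the Okamoto function with parameter `a`. -/
theorem okamoto_graph_eq_iInter (a : ℝ) (ha : a ∈ Set.Ioo (0 : ℝ) 1)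
    (F : ℝ → ℝ) (hF : IsOkamoto a F)
    (w₁ w₂ w₃ : ℝ × ℝ → ℝ × ℝ)
    (hw₁ : ∀ p : ℝ × ℝ, w₁ p = (p.1 / 3, a * p.2))
    (hw₂ : ∀ p : ℝ × ℝ, w₂ p = ((2 - p.1) / 3, (2 * a - 1) * p.2 + (1 - a)))
    (hw₃ : ∀ p : ℝ × ℝ, w₃ p = ((2 + p.1) / 3, a * p.2 + (1 - a)))
    (E : ℕ → Set (ℝ × ℝ))
    (hE0 : E 0 = Set.Icc (0 : ℝ) 1 ×ˢ Set.Icc (0 : ℝ) 1)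
    (hEsucc : ∀ i : ℕ, E (i + 1) = w₁ '' E i ∪ w₂ '' E i ∪ w₃ '' E i) :
    (∀ i : ℕ, E (i + 1) ⊆ E i) ∧ (⋂ i : ℕ, E i) = okamotoGraph F := by
  have hmaps := hF.mapsTo_Icc ha
  obtain ⟨ha0, ha1⟩ := ha
  obtain ⟨-, hF⟩ := hF
  have hnested : ∀ i : ℕ, E (i + 1) ⊆ E i := by
    intro i
    induction i with
    | zero =>
      rw [hEsucc, hE0]
      rintro p ((⟨q, ⟨⟨hx0, hx1⟩, hy0, hy1⟩, rfl⟩ | ⟨q, ⟨⟨hx0, hx1⟩, hy0, hy1⟩, rfl⟩) |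
        ⟨q, ⟨⟨hx0, hx1⟩, hy0, hy1⟩, rfl⟩)
      · rw [hw₁]
        refine ⟨⟨?_, ?_⟩, ?_, ?_⟩ <;> dsimp only <;> nlinarith
      · rw [hw₂]
        refine ⟨⟨?_, ?_⟩, ?_, ?_⟩ <;> dsimp only <;> nlinarith
      · rw [hw₃]
        refine ⟨⟨?_, ?_⟩, ?_, ?_⟩ <;> dsimp only <;> nlinarith
    | succ i ih =>
      rw [hEsucc (i + 1)]
      conv_rhs => rw [hEsucc i]
      exact union_subset_union (union_subset_union (image_mono ih) (image_mono ih))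
        (image_mono ih)
  refine ⟨hnested, Subset.antisymm ?_ ?_⟩
  · set r := max a |2 * a - 1|
    have har : a ≤ r := le_max_left _ _
    have hbr : |2 * a - 1| ≤ r := le_max_right _ _
    have hr1 : r < 1 := max_lt ha1 (abs_lt.2 ⟨by linarith, by linarith⟩)
    have hr0 : 0 ≤ r := ha0.le.trans har
    have hclose : ∀ n : ℕ, ∀ p ∈ E n, p.1 ∈ Set.Icc (0 : ℝ) 1 ∧ |p.2 - F p.1| ≤ r ^ n := by
      intro n
      induction n with
      | zero =>
        intro p hp
        rw [hE0] at hp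
        obtain ⟨hx, hy0, hy1⟩ := hp
        obtain ⟨hF0, hF1⟩ := hmaps hx
        exact ⟨hx, by rw [pow_zero, abs_le]; constructor <;> linarith⟩
      | succ n ih =>
        have hcontract : ∀ {c : ℝ}, |c| ≤ r → ∀ q ∈ E n, |c * (q.2 - F q.1)| ≤ r ^ (n + 1) := by
          intro c hc q hq
          rw [abs_mul, pow_succ']
          exact mul_le_mul hc (ih q hq).2 (abs_nonneg _) hr0
        have haa : |a| ≤ r := by rwa [abs_of_pos ha0]
        rw [hEsucc]
        rintro p ((⟨q, hq, rfl⟩ | ⟨q, hq, rfl⟩) | ⟨q, hq, rfl⟩)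
        all_goals
          have hx := (ih q hq).1
          obtain ⟨h₁, h₂, h₃⟩ := hF q.1 hx
          obtain ⟨hx0, hx1⟩ := hx
        · rw [hw₁]
          refine ⟨⟨by dsimp only; linarith, by dsimp only; linarith⟩, ?_⟩
          convert hcontract haa q hq using 2
          rw [h₁]; ring
        · rw [hw₂]
          refine ⟨⟨by dsimp only; linarith, by dsimp only; linarith⟩, ?_⟩
          convert hcontract hbr q hq using 2
          rw [h₂]; ring
        · rw [hw₃]
          refine ⟨⟨by dsimp only; linarith, by dsimp only; linarith⟩, ?_⟩
          convert hcontract haa q hq using 2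
          rw [h₃]; ring
    intro p hp
    rw [mem_iInter] at hp
    have h0 : |p.2 - F p.1| ≤ 0 :=
      ge_of_tendsto' (tendsto_pow_atTop_nhds_zero_of_lt_one hr0 hr1)
        fun n => (hclose n p (hp n)).2
    refine ⟨p.1, (hclose 0 p (hp 0)).1, Prod.ext rfl ?_⟩
    exact (sub_eq_zero.1 (abs_nonpos_iff.1 h0)).symm
  · have hgraph : ∀ n : ℕ, ∀ x ∈ Set.Icc (0 : ℝ) 1, (x, F x) ∈ E n := by
      intro n
      induction n with
      | zero =>
        intro x hx
        rw [hE0]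
        exact ⟨hx, hmaps hx⟩
      | succ n ih =>
        intro x hx
        obtain ⟨t, ht, h⟩ := exists_preimage_thirds hx
        obtain ⟨h₁, h₂, h₃⟩ := hF t ht
        rw [hEsucc]
        rcases h with rfl | rfl | rfl
        · exact Or.inl (Or.inl ⟨(t, F t), ih t ht, by rw [hw₁, h₁]⟩)
        · exact Or.inl (Or.inr ⟨(t, F t), ih t ht, by rw [hw₂, h₂]⟩)
        · exact Or.inr ⟨(t, F t), ih t ht, by rw [hw₃, h₃]⟩
    rintro _ ⟨x, hx, rfl⟩
    exact mem_iInter.2 fun n => hgraph n x hx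
end
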